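/- For every fair division instance with n agents and additive valuations, and every α with 0 ≤ α ≤ 6/7, there exists an allocation with copies (A_1,…,A_n) such that v_i(A_i) ≥ α·μ_i^n(M) for every agent i, each good belongs to at most two of the bundles, and at most ⌊n/2⌋ goods belong to two bundles (i.e., a 6/7-approximate MMS allocation using at most ⌊n/2⌋ distinct copies, each good copied at most once). -/

import Mathlib

open Finset

/-- The `d`-maximin share of valuation `v` over the set `S` of goods:
the maximum over partitions of `S` into `d` bundles of the minimum bundle value. -/
noncomputable def mms {G : Type*} (v : Finset G → ℝ) (d : ℕ) (S : Finset G) : ℝ :=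
  ⨆ P : G → Fin d, ⨅ j : Fin d, v (S.filter fun g => P g = j)


/-- `v` admits `n` disjoint finite bundles of positions, each worth at least `μ`. -/
def HasParts (v : ℕ → ℝ) (n : ℕ) (μ : ℝ) : Prop :=
  ∃ (P : ℕ → ℕ) (L : Finset ℕ) (m : ℕ), n ≤ L.card ∧
    ∀ l ∈ L, μ ≤ ∑ p ∈ range m with P p = l, v p

lemma sum_label_le_sum_label_swap {v : ℕ → ℝ} (hv : Antitone v) (P : ℕ → ℕ) {m x y : ℕ}
    (hxy : x ≤ y) (hy : y < m) {l : ℕ} (hl : l ≠ P x) :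
    ∑ p ∈ range m with P p = l, v p ≤ ∑ p ∈ range m with P (Equiv.swap x y p) = l, v p := by
  have hlt : ∀ p, p < m → Equiv.swap x y p < m := by
    intro p hp
    rw [Equiv.swap_apply_def]
    split_ifs <;> omega
  have h : ∑ p ∈ range m with P (Equiv.swap x y p) = l, v p
      = ∑ p ∈ range m with P p = l, v (Equiv.swap x y p) := by
    refine sum_nbij' (Equiv.swap x y) (Equiv.swap x y) ?_ ?_ ?_ ?_ ?_ <;>
      simp +contextual [hlt]
  rw [h]
  refine sum_le_sum fun p hp => hv ?_
  have hpx : p ≠ x := by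
    rintro rfl
    exact hl (mem_filter.1 hp).2.symm
  rw [Equiv.swap_apply_def]
  split_ifs <;> omega

/-- Positions labelled `j` can be moved to the end of an initial segment
without making any other bundle worse. -/
lemma exists_label_gathered {v : ℕ → ℝ} (hv : Antitone v) (j m : ℕ) (k : ℕ) :
    ∀ (y : ℕ) (P : ℕ → ℕ), y ≤ m → k ≤ #{p ∈ range y | P p = j} → ∃ P' : ℕ → ℕ,
      (∀ l, l ≠ j → ∑ p ∈ range m with P p = l, v p ≤ ∑ p ∈ range m with P' p = l, v p) ∧
      (∀ p, y - k ≤ p → p < y → P' p = j) ∧ ∀ p, y ≤ p → P' p = P p := by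
  induction k with
  | zero => exact fun y P _ _ => ⟨P, fun _ _ => le_rfl, fun p h₁ h₂ => by omega, fun _ _ => rfl⟩
  | succ k ih =>
    intro y P hy hk
    obtain ⟨x, hx⟩ : ({p ∈ range y | P p = j}).Nonempty := card_pos.1 (by omega)
    obtain ⟨hxy, hxj⟩ := mem_filter.1 hx
    rw [mem_range] at hxy
    obtain ⟨y, rfl⟩ : ∃ z, y = z + 1 := ⟨y - 1, by omega⟩
    by_cases hyj : P y = j
    · obtain ⟨P', h₁, h₂, h₃⟩ := ih y P (by omega) (by
        rw [range_add_one, filter_insert, if_pos hyj, card_insert_of_notMem (by simp)] at hk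
        omega)
      refine ⟨P', h₁, fun p hp hp' => ?_, fun p hp => h₃ p (by omega)⟩
      rcases eq_or_ne p y with rfl | hne
      · rw [h₃ p le_rfl, hyj]
      · exact h₂ p (by omega) (by omega)
    · have hne : x ≠ y := by rintro rfl; exact hyj hxj
      obtain ⟨P', h₁, h₂, h₃⟩ := ih y (fun p => P (Equiv.swap x y p)) (by omega) (by
        have hsub : ({p ∈ range (y + 1) | P p = j}).erase x ⊆
            {p ∈ range y | P (Equiv.swap x y p) = j} := by
          intro p hp
          simp only [mem_erase, mem_filter, mem_range] at hp ⊢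
          have hpy : p ≠ y := by rintro rfl; exact hyj hp.2.2
          rw [Equiv.swap_apply_of_ne_of_ne hp.1 hpy]
          exact ⟨by omega, hp.2.2⟩
        have := card_le_card hsub
        rw [card_erase_of_mem hx] at this
        omega)
      refine ⟨P', fun l hl => ?_, fun p hp hp' => ?_, fun p hp => ?_⟩
      · exact (sum_label_le_sum_label_swap hv P (by omega) (by omega) (by rwa [hxj])).trans
          (h₁ l hl)
      · rcases eq_or_ne p y with rfl | hpy
        · rw [h₃ p le_rfl, Equiv.swap_apply_right, hxj]
        · exact h₂ p (by omega) (by omega)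
      · rw [h₃ p (by omega), Equiv.swap_apply_of_ne_of_ne (by omega) (by omega)]

lemma HasParts.exists_gathered {v : ℕ → ℝ} (hv : Antitone v) (hv0 : ∀ p, 0 ≤ v p) {n : ℕ}
    {μ : ℝ} (h : HasParts v n μ) (hn : 1 ≤ n) (k : ℕ) :
    ∃ (P : ℕ → ℕ) (L : Finset ℕ) (m j : ℕ), L.card = n ∧ j ∈ L ∧
      (∀ p, k * n - k ≤ p → p ≤ k * n → P p = j) ∧
      ∀ l ∈ L.erase j, μ ≤ ∑ p ∈ range m with P p = l, v p := by
  obtain ⟨P, L, m, hL, hP⟩ := h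
  obtain ⟨L, hLL, rfl⟩ := exists_subset_card_eq hL
  obtain ⟨l₀, hl₀⟩ : L.Nonempty := card_pos.1 hn
  let Q : ℕ → ℕ := fun p => if P p ∈ L then P p else l₀
  have hQL : ∀ p, Q p ∈ L := by
    intro p
    simp only [Q]
    split_ifs <;> assumption
  let M := max m (k * L.card + 1)
  have hQ : ∀ l ∈ L, μ ≤ ∑ p ∈ range M with Q p = l, v p := by
    intro l hl
    refine (hP l (hLL hl)).trans (sum_le_sum_of_subset_of_nonneg ?_ fun _ _ _ => hv0 _)
    intro p hp
    simp only [mem_filter, mem_range, Q, M] at hp ⊢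
    obtain ⟨hp, rfl⟩ := hp
    exact ⟨by omega, if_pos hl⟩
  obtain ⟨j, hj, hjc⟩ := exists_lt_card_fiber_of_mul_lt_card_of_maps_to
    (s := range (k * L.card + 1)) (t := L) (f := Q) (n := k) (fun p _ => hQL p)
    (by rw [card_range, mul_comm]; omega)
  obtain ⟨P', h₁, h₂, -⟩ := exists_label_gathered hv j M (k + 1) (k * L.card + 1) Q
    (le_max_right _ _) hjc
  refine ⟨P', L, M, j, rfl, hj, fun p hp hp' => h₂ p (by omega) (by omega), fun l hl => ?_⟩
  rw [mem_erase] at hl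
  exact (hQ l hl.2).trans (h₁ l hl.1)

lemma hasParts_comp {v : ℕ → ℝ} (hv0 : ∀ p, 0 ≤ v p) {μ : ℝ} {P : ℕ → ℕ} {L : Finset ℕ} {m : ℕ}
    (h : ∀ l ∈ L, μ ≤ ∑ p ∈ range m with P p = l, v p) (e : ℕ ↪o ℕ)
    (he : ∀ p, P p ∈ L → p ∈ Set.range e) : HasParts (v ∘ e) L.card μ := by
  refine ⟨P ∘ e, L, m, le_rfl, fun l hl => (h l hl).trans ?_⟩
  refine le_of_le_of_eq ?_ (sum_map {p ∈ range m | (P ∘ e) p = l} e.toEmbedding v)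
  refine sum_le_sum_of_subset_of_nonneg ?_ fun _ _ _ => hv0 _
  intro p hp
  simp only [mem_filter, mem_range] at hp
  obtain ⟨q, rfl⟩ := he p (hp.2 ▸ hl)
  simp only [mem_map, mem_filter, mem_range]
  exact ⟨q, ⟨(e.strictMono.le_apply).trans_lt hp.1, hp.2⟩, rfl⟩

lemma exists_orderEmbedding_avoiding (R : Finset ℕ) :
    ∃ e : ℕ ↪o ℕ, ∀ p, p ∈ Set.range e ↔ p ∉ R := by
  classical
  have : Infinite ((R : Set ℕ)ᶜ : Set ℕ) := R.finite_toSet.infinite_compl.to_subtype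
  refine ⟨Nat.orderEmbeddingOfSet ((R : Set ℕ)ᶜ), fun p => ?_⟩
  rw [Nat.orderEmbeddingOfSet_range]
  simp

/-- Removing three consecutive positions, one of them among the first `2 n + 1`-st,
costs at most one bundle. -/
lemma HasParts.comp_of_triple {v : ℕ → ℝ} (hv : Antitone v) (hv0 : ∀ p, 0 ≤ v p) {n : ℕ}
    {μ : ℝ} (h : HasParts v n μ) (hn : 1 ≤ n) (e : ℕ ↪o ℕ)
    (he : ∀ p, p ∈ Set.range e ↔ p ∉ ({2 * n - 2, 2 * n - 1, 2 * n} : Finset ℕ)) :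
    HasParts (v ∘ e) (n - 1) μ := by
  obtain ⟨P, L, m, j, hL, hj, hPj, hP⟩ := h.exists_gathered hv hv0 hn 2
  rw [← hL, ← card_erase_of_mem hj]
  refine hasParts_comp hv0 hP e fun p hp => (he p).2 fun hpR => ?_
  refine (mem_erase.1 hp).1 (hPj p ?_ ?_) <;>
  · simp only [mem_insert, mem_singleton] at hpR
    omega

/-- Removing the first position and the positions of ranks `n` and `n + 1`
costs at most two bundles. -/
lemma HasParts.comp_of_pair {v : ℕ → ℝ} (hv : Antitone v) (hv0 : ∀ p, 0 ≤ v p) {n : ℕ}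
    {μ : ℝ} (h : HasParts v n μ) (hn : 1 ≤ n) (e : ℕ ↪o ℕ)
    (he : ∀ p, p ∈ Set.range e ↔ p ∉ ({0, n - 1, n} : Finset ℕ)) :
    HasParts (v ∘ e) (n - 2) μ := by
  obtain ⟨P, L, m, j, hL, hj, hPj, hP⟩ := h.exists_gathered hv hv0 hn 1
  obtain ⟨Q, L', m', hL', hQ⟩ := hasParts_comp (L := (L.erase j).erase (P 0)) hv0
    (fun l hl => hP l (mem_of_mem_erase hl)) e fun p hp => (he p).2 fun hpR => by
      simp only [mem_insert, mem_singleton] at hpR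
      simp only [mem_erase] at hp
      rcases hpR with rfl | hpR
      · exact hp.1 rfl
      · exact hp.2.1 (hPj p (by omega) (by omega))
  refine ⟨Q, L', m', le_trans ?_ hL', hQ⟩
  have h₁ := pred_card_le_card_erase (s := L.erase j) (a := P 0)
  rw [card_erase_of_mem hj] at h₁
  omega

/-- Bag filling: bag `j ∈ Q` starts with value `β i j` for agent `i`, and the goods of `F`, each
worth at most `y i` to agent `i`, are added until some agent reaches its target `t i`. -/
lemma exists_bagFilling {ι : Type*} [DecidableEq ι] (v : ι → ℕ → ℝ)
    (t y : ι → ℝ) (β : ι → ℕ → ℝ) (k : ℕ) : ∀ (J : Finset ι) (Q F : Finset ℕ),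
    J.card = k → Q.card = k →
    (∀ i ∈ J, ∀ p ∈ F, v i p ≤ y i) →
    (∀ i ∈ J, ∑ j ∈ Q, max (β i j) (t i + y i) ≤ ∑ j ∈ Q, β i j + ∑ p ∈ F, v i p + y i) →
    ∃ (b : ι → ℕ) (S : ι → Finset ℕ), (∀ i ∈ J, b i ∈ Q) ∧ (∀ i ∈ J, S i ⊆ F) ∧
      (∀ i ∈ J, t i ≤ β i (b i) + ∑ p ∈ S i, v i p) ∧
      ∀ i ∈ J, ∀ i' ∈ J, i ≠ i' → b i ≠ b i' ∧ Disjoint (S i) (S i') := by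
  induction k with
  | zero =>
    intro J Q F hJ hQ _ _
    rw [card_eq_zero] at hJ
    subst hJ
    exact ⟨fun _ => 0, fun _ => ∅, by simp⟩
  | succ k ih =>
    intro J Q F hJ hQ hy hinv
    obtain ⟨j, hj⟩ : Q.Nonempty := card_pos.1 (by omega)
    obtain ⟨i₀, hi₀⟩ : J.Nonempty := card_pos.1 (by omega)
    have hF : ∃ S ⊆ F, ∃ i ∈ J, t i ≤ β i j + ∑ p ∈ S, v i p := by
      refine ⟨F, subset_rfl, i₀, hi₀, ?_⟩
      have h₁ := hinv i₀ hi₀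
      rw [← add_sum_erase _ _ hj, ← add_sum_erase Q (β i₀) hj] at h₁
      have h₂ : ∑ x ∈ Q.erase j, β i₀ x ≤ ∑ x ∈ Q.erase j, max (β i₀ x) (t i₀ + y i₀) :=
        sum_le_sum fun _ _ => le_max_left _ _
      have h₃ := le_max_right (β i₀ j) (t i₀ + y i₀)
      linarith
    have hfin : {S | S ⊆ F ∧ ∃ i ∈ J, t i ≤ β i j + ∑ p ∈ S, v i p}.Finite :=
      F.powerset.finite_toSet.subset fun S h => mem_powerset.2 h.1
    obtain ⟨S, hS⟩ := hfin.exists_minimal hF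
    obtain ⟨⟨hSF, i, hi, hit⟩, hmin⟩ := hS
    have hcap : ∀ i' ∈ J, β i' j + ∑ p ∈ S, v i' p ≤ max (β i' j) (t i' + y i') := by
      intro i' hi'
      rcases S.eq_empty_or_nonempty with rfl | ⟨x, hx⟩
      · simp
      · refine le_trans ?_ (le_max_right _ _)
        rw [← add_sum_erase _ _ hx]
        have h₁ := hy i' hi' x (hSF hx)
        by_contra! h₂
        have h₃ := hmin ⟨(erase_subset x S).trans hSF, i', hi', by linarith⟩ (erase_subset x S) hx
        simp at h₃
    obtain ⟨b, T, hb, hT, ht, hd⟩ := ih (J.erase i) (Q.erase j) (F \ S)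
      (by rw [card_erase_of_mem hi]; omega) (by rw [card_erase_of_mem hj]; omega)
      (fun i' hi' p hp => hy i' (mem_of_mem_erase hi') p (mem_sdiff.1 hp).1)
      (fun i' hi' => by
        have h₁ := hinv i' (mem_of_mem_erase hi')
        have h₂ := hcap i' (mem_of_mem_erase hi')
        rw [← add_sum_erase _ _ hj, ← add_sum_erase Q (β i') hj, ← sum_sdiff hSF] at h₁
        linarith)
    refine ⟨Function.update b i j, Function.update T i S, ?_, ?_, ?_, ?_⟩
    · intro a ha
      rcases eq_or_ne a i with rfl | hne
      · simpa using hj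
      · simpa [hne] using mem_of_mem_erase (hb a (mem_erase.2 ⟨hne, ha⟩))
    · intro a ha
      rcases eq_or_ne a i with rfl | hne
      · simpa using hSF
      · simpa [hne] using (hT a (mem_erase.2 ⟨hne, ha⟩)).trans sdiff_subset
    · intro a ha
      rcases eq_or_ne a i with rfl | hne
      · simpa using hit
      · simpa [hne] using ht a (mem_erase.2 ⟨hne, ha⟩)
    · have key : ∀ a ∈ J, a ≠ i → j ≠ b a ∧ Disjoint S (T a) := by
        intro a ha hne
        have ha' := mem_erase.2 ⟨hne, ha⟩
        exact ⟨(ne_of_mem_erase (hb a ha')).symm,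
          disjoint_sdiff.mono_right (hT a ha')⟩
      intro a ha a' ha' hne
      rcases eq_or_ne a i with rfl | h₁
      · simpa [hne.symm] using key a' ha' hne.symm
      · rcases eq_or_ne a' i with rfl | h₂
        · simpa [h₁] using (key a ha h₁).imp Ne.symm fun h => h.symm
        · simpa [h₁, h₂] using hd a (mem_erase.2 ⟨h₁, ha⟩) a' (mem_erase.2 ⟨h₂, ha'⟩) hne

/-- An allocation with copies of the positions `0, 1, 2, …` to the agents of `I`: agent `i` receives
the originals `P i` and the copies `C i`, worth at least `t i` together, there are at most half as
many copies as agents, and whoever receives a copy receives no other duplicated position. -/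
structure IsCopyAlloc {ι : Type*} (I : Finset ι) (v : ι → ℕ → ℝ) (t : ι → ℝ)
    (P C : ι → Finset ℕ) : Prop where
  le_value : ∀ i ∈ I, t i ≤ ∑ p ∈ P i, v i p + ∑ p ∈ C i, v i p
  eq_empty : ∀ i, i ∉ I → P i = ∅ ∧ C i = ∅
  disjoint_originals : ∀ i j, i ≠ j → Disjoint (P i) (P j)
  disjoint_copies : ∀ i j, i ≠ j → Disjoint (C i) (C j)
  card_copies_le : ∀ i, (C i).card ≤ 1
  disjoint_originals_copies : ∀ i j, (C i).Nonempty → Disjoint (P i) (C j)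
  two_mul_card_copies_le : 2 * ∑ i ∈ I, (C i).card ≤ I.card

namespace IsCopyAlloc

variable {ι : Type*} [DecidableEq ι]

lemma union {I J : Finset ι} {v : ι → ℕ → ℝ} {t : ι → ℝ} {P C P' C' : ι → Finset ℕ}
    (e : ℕ ↪o ℕ) (hIJ : Disjoint I J) (h : IsCopyAlloc I v t P C)
    (hPe : ∀ i, ∀ p ∈ P i, p ∉ Set.range e) (hCe : ∀ i, ∀ p ∈ C i, p ∉ Set.range e)
    (h' : IsCopyAlloc J (fun i => v i ∘ e) t P' C') :
    IsCopyAlloc (I ∪ J) v t (fun i => if i ∈ I then P i else (P' i).map e.toEmbedding)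
      (fun i => if i ∈ I then C i else (C' i).map e.toEmbedding) := by
  have hmap : ∀ (A B : Finset ℕ), (∀ p ∈ A, p ∉ Set.range e) →
      Disjoint A (B.map e.toEmbedding) := by
    intro A B hA
    rw [disjoint_right]
    intro p hp hpA
    obtain ⟨q, -, rfl⟩ := mem_map.1 hp
    exact hA _ hpA ⟨q, rfl⟩
  have hJ : ∀ j ∈ J, j ∉ I := fun j hj hjI => disjoint_left.1 hIJ hjI hj
  constructor
  · intro i hi
    by_cases hiI : i ∈ I
    · simpa [hiI] using h.le_value i hiI
    · simpa [hiI] using h'.le_value i ((mem_union.1 hi).resolve_left hiI)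
  · intro i hi
    rw [mem_union, not_or] at hi
    simp [hi.1, h'.eq_empty i hi.2]
  · intro i j hij
    by_cases hi : i ∈ I <;> by_cases hj : j ∈ I <;> simp only [hi, hj, if_true, if_false]
    · exact h.disjoint_originals i j hij
    · exact hmap _ _ (hPe i)
    · exact (hmap _ _ (hPe j)).symm
    · exact (disjoint_map _).2 (h'.disjoint_originals i j hij)
  · intro i j hij
    by_cases hi : i ∈ I <;> by_cases hj : j ∈ I <;> simp only [hi, hj, if_true, if_false]
    · exact h.disjoint_copies i j hij
    · exact hmap _ _ (hCe i)
    · exact (hmap _ _ (hCe j)).symm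
    · exact (disjoint_map _).2 (h'.disjoint_copies i j hij)
  · intro i
    split_ifs
    · exact h.card_copies_le i
    · simpa using h'.card_copies_le i
  · intro i j
    by_cases hi : i ∈ I <;> by_cases hj : j ∈ I <;> simp only [hi, hj, if_true, if_false]
    · exact h.disjoint_originals_copies i j
    · exact fun _ => hmap _ _ (hPe i)
    · exact fun _ => (hmap _ _ (hCe j)).symm
    · rw [map_nonempty, disjoint_map]
      exact h'.disjoint_originals_copies i j
  · have h₁ := h.two_mul_card_copies_le
    have h₂ := h'.two_mul_card_copies_le
    rw [sum_union hIJ, card_union_of_disjoint hIJ]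
    have e₁ : ∑ i ∈ I, (if i ∈ I then C i else (C' i).map e.toEmbedding).card
        = ∑ i ∈ I, (C i).card := sum_congr rfl fun i hi => by rw [if_pos hi]
    have e₂ : ∑ i ∈ J, (if i ∈ I then C i else (C' i).map e.toEmbedding).card
        = ∑ i ∈ J, (C' i).card := sum_congr rfl fun i hi => by rw [if_neg (hJ i hi), card_map]
    rw [e₁, e₂]
    omega

lemma singleton {v : ι → ℕ → ℝ} {t : ι → ℝ} {i : ι} {A : Finset ℕ} (h : t i ≤ ∑ p ∈ A, v i p) :
    IsCopyAlloc {i} v t (fun a => if a = i then A else ∅) fun _ => ∅ where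
  le_value := by simpa using h
  eq_empty a ha := by simpa using fun h => absurd h (by simpa using ha)
  disjoint_originals a b hab := by
    by_cases ha : a = i <;> by_cases hb : b = i <;> simp_all
  disjoint_copies := by simp
  card_copies_le := by simp
  disjoint_originals_copies := by simp
  two_mul_card_copies_le := by simp

/-- Two agents share position `0`. -/
lemma pair {v : ι → ℕ → ℝ} {t : ι → ℝ} {i j : ι} {x y : ℕ} (hij : i ≠ j) (hx : x ≠ 0)
    (hxy : x ≠ y) (hy : y ≠ 0) (hi : t i ≤ v i 0 + v i x) (hj : t j ≤ v j 0 + v j y) :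
    IsCopyAlloc {i, j} v t (fun a => if a = i then {0, x} else if a = j then {y} else ∅)
      fun a => if a = j then {0} else ∅ where
  le_value a ha := by
    rcases mem_insert.1 ha with rfl | ha
    · simpa [hij, sum_pair hx.symm] using hi
    · rw [mem_singleton.1 ha]
      simpa [hij.symm, add_comm] using hj
  eq_empty a ha := by
    simp only [mem_insert, mem_singleton, not_or] at ha
    simp [ha.1, ha.2]
  disjoint_originals a b hab := by
    by_cases ha : a = i <;> by_cases hb : b = i <;> by_cases ha' : a = j <;>
      by_cases hb' : b = j <;> simp_all [Ne.symm]
  disjoint_copies a b hab := by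
    by_cases ha : a = j <;> by_cases hb : b = j <;> simp_all
  card_copies_le a := by split_ifs <;> simp
  disjoint_originals_copies a b ha := by
    by_cases ha' : a = j
    · by_cases hb : b = j <;> simp [ha', hb, hij.symm, hy]
    · simp [ha'] at ha
  two_mul_card_copies_le := by simp [sum_pair hij, card_pair hij, hij]

end IsCopyAlloc

lemma HasParts.exists_mul_le_sum {v : ℕ → ℝ} (hv0 : ∀ p, 0 ≤ v p) {n : ℕ} {μ : ℝ}
    (h : HasParts v n μ) : ∃ m₀, ∀ m, m₀ ≤ m → n * μ ≤ ∑ p ∈ range m, v p := by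
  obtain ⟨P, L, m₀, hL, hP⟩ := h
  obtain ⟨L, hLL, rfl⟩ := exists_subset_card_eq hL
  refine ⟨m₀, fun m hm => ?_⟩
  calc L.card * μ = ∑ _l ∈ L, μ := by rw [sum_const, nsmul_eq_mul]
    _ ≤ ∑ l ∈ L, ∑ p ∈ range m₀ with P p = l, v p := sum_le_sum fun l hl => hP l (hLL hl)
    _ = ∑ p ∈ range m₀ with P p ∈ L, v p := by
      rw [← sum_fiberwise_of_maps_to (g := P) (t := L) fun p hp => (mem_filter.1 hp).2]
      refine sum_congr rfl fun l hl => sum_congr ?_ fun _ _ => rfl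
      ext p
      simp only [mem_filter, and_assoc]
      exact and_congr_right fun _ => ⟨fun h => ⟨h ▸ hl, h⟩, fun h => h.2⟩
    _ ≤ ∑ p ∈ range m, v p := sum_le_sum_of_subset_of_nonneg
      ((filter_subset _ _).trans (range_subset_range.2 hm)) fun _ _ _ => hv0 _

/-- The position, if any, whose copy is put into the `j`-th of `n` bags. -/
def bagCopy (n j : ℕ) : Finset ℕ := if n - n / 2 ≤ j then {n - 1 - j} else ∅

/-- The initial content of the `j`-th of `n` bags. -/
def bagOriginals (n j : ℕ) : Finset ℕ := {j, n + j}

lemma sum_max_bag_le {v : ℕ → ℝ} (hv : Antitone v) (hv0 : ∀ p, 0 ≤ v p) {n m : ℕ} {t μ : ℝ}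
    (hn : 1 ≤ n) (hm : 2 * n ≤ m) (hμ : n * μ ≤ ∑ p ∈ range m, v p) (ht : t = 6 / 7 * μ)
    (hy : 3 * v (2 * n) ≤ t) (hpair : v 0 + v n ≤ t) :
    ∑ j ∈ range n, max (∑ p ∈ bagOriginals n j, v p + ∑ p ∈ bagCopy n j, v p) (t + v (2 * n)) ≤
      ∑ j ∈ range n, (∑ p ∈ bagOriginals n j, v p + ∑ p ∈ bagCopy n j, v p)
        + ∑ p ∈ Ico (2 * n) m, v p + v (2 * n) := by
  have hO : ∀ j, ∑ p ∈ bagOriginals n j, v p = v j + v (n + j) := fun j =>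
    sum_pair (by omega)
  have hmax : ∀ j ∈ range n,
      max (∑ p ∈ bagOriginals n j, v p + ∑ p ∈ bagCopy n j, v p) (t + v (2 * n)) ≤
        t + ∑ p ∈ bagCopy n j, v p + if j < n - n / 2 then v (2 * n) else 0 := by
    intro j _
    have h₁ := hv (Nat.zero_le j)
    have h₂ := hv (Nat.le_add_right n j)
    have h₃ := hv0 (2 * n)
    rw [hO, bagCopy]
    by_cases hj : n - n / 2 ≤ j
    · have h₄ := hv (show n - 1 - j ≤ 2 * n by omega)
      rw [if_pos hj, if_neg (by omega), sum_singleton]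
      exact max_le (by linarith) (by linarith)
    · rw [if_neg hj, if_pos (by omega), sum_empty]
      exact max_le (by linarith) (by linarith)
  refine (sum_le_sum hmax).trans ?_
  have hcount : ∑ j ∈ range n, (if j < n - n / 2 then v (2 * n) else 0)
      = ((n - n / 2 : ℕ) : ℝ) * v (2 * n) := by
    rw [← sum_filter, sum_const, nsmul_eq_mul]
    congr 2
    have : {j ∈ range n | j < n - n / 2} = range (n - n / 2) := by
      ext j
      simp only [mem_filter, mem_range]
      omega
    rw [this, card_range]
  have htotal : ∑ j ∈ range n, ∑ p ∈ bagOriginals n j, v p + ∑ p ∈ Ico (2 * n) m, v p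
      = ∑ p ∈ range m, v p := by
    simp_rw [hO]
    rw [sum_add_distrib, ← sum_range_add_sum_Ico v hm, two_mul, sum_range_add]
  rw [sum_add_distrib, sum_add_distrib, sum_add_distrib, hcount, sum_const, card_range,
    nsmul_eq_mul]
  have hk : (2 : ℝ) * ((n - n / 2 : ℕ) : ℝ) ≤ n + 1 := by
    have : 2 * (n - n / 2) ≤ n + 1 := by omega
    exact_mod_cast this
  have h₁ := mul_le_mul_of_nonneg_right hk (hv0 (2 * n))
  have h₂ : (n : ℝ) * (3 * v (2 * n)) ≤ n * t := mul_le_mul_of_nonneg_left hy (Nat.cast_nonneg n)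
  have h₃ := hv0 (2 * n)
  subst ht
  linarith

section

variable {ι : Type*} [DecidableEq ι]

/-- The bags and fillings of distinct agents form an allocation with copies. -/
lemma isCopyAlloc_of_bags {I : Finset ι} {v : ι → ℕ → ℝ} {t : ι → ℝ} {b : ι → ℕ}
    {S : ι → Finset ℕ} {n : ℕ} (hn : n = I.card) (hb : ∀ i ∈ I, b i < n)
    (hS : ∀ i ∈ I, ∀ p ∈ S i, 2 * n ≤ p)
    (ht : ∀ i ∈ I, t i ≤ ∑ p ∈ bagOriginals n (b i), v i p + ∑ p ∈ bagCopy n (b i), v i p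
      + ∑ p ∈ S i, v i p)
    (hd : ∀ i ∈ I, ∀ j ∈ I, i ≠ j → b i ≠ b j ∧ Disjoint (S i) (S j)) :
    IsCopyAlloc I v t (fun i => if i ∈ I then bagOriginals n (b i) ∪ S i else ∅)
      fun i => if i ∈ I then bagCopy n (b i) else ∅ := by
  have hO : ∀ j p, p ∈ bagOriginals n j ↔ p = j ∨ p = n + j := by simp [bagOriginals]
  have hC : ∀ j p, p ∈ bagCopy n j ↔ n - n / 2 ≤ j ∧ p = n - 1 - j := by
    intro j p
    rw [bagCopy]
    split_ifs with h <;> simp [h]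
  have hOS : ∀ i ∈ I, ∀ j ∈ I, Disjoint (bagOriginals n (b i)) (S j) := by
    intro i hi j hj
    rw [disjoint_left]
    intro p hp hp'
    have h₁ := hS j hj p hp'
    have h₂ := hb i hi
    rw [hO] at hp
    omega
  constructor
  · intro i hi
    simp only [hi, if_true]
    rw [sum_union (hOS i hi i hi)]
    linarith [ht i hi]
  · intro i hi
    simp [hi]
  · intro i j hij
    by_cases hi : i ∈ I <;> by_cases hj : j ∈ I <;>
      simp only [hi, hj, if_true, if_false, disjoint_empty_left, disjoint_empty_right]
    obtain ⟨h₁, h₂⟩ := hd i hi j hj hij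
    rw [disjoint_union_left, disjoint_union_right, disjoint_union_right]
    refine ⟨⟨?_, hOS i hi j hj⟩, (hOS j hj i hi).symm, h₂⟩
    rw [disjoint_left]
    intro p hp hp'
    have := hb i hi
    have := hb j hj
    rw [hO] at hp hp'
    omega
  · intro i j hij
    by_cases hi : i ∈ I <;> by_cases hj : j ∈ I <;>
      simp only [hi, hj, if_true, if_false, disjoint_empty_left, disjoint_empty_right]
    obtain ⟨h₁, h₂⟩ := hd i hi j hj hij
    rw [disjoint_left]
    intro p hp hp'
    have := hb i hi
    have := hb j hj
    rw [hC] at hp hp'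
    omega
  · intro i
    rw [bagCopy]
    split_ifs <;> simp
  · intro i j ⟨c, hc⟩
    by_cases hi : i ∈ I <;> by_cases hj : j ∈ I <;>
      simp only [hi, hj, if_true, if_false, disjoint_empty_left, disjoint_empty_right] at hc ⊢
    rw [hC] at hc
    rw [disjoint_left]
    intro p hp hp'
    have := hb i hi
    have := hb j hj
    rw [hC] at hp'
    rw [mem_union, hO] at hp
    rcases hp with hp | hp
    · omega
    · have := hS i hi p hp
      omega
  · have h₁ : ∑ i ∈ I, (if i ∈ I then bagCopy n (b i) else ∅).card
        = #{i ∈ I | n - n / 2 ≤ b i} := by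
      rw [card_filter]
      refine sum_congr rfl fun i hi => ?_
      rw [if_pos hi, bagCopy]
      split_ifs <;> simp
    have h₂ : #{i ∈ I | n - n / 2 ≤ b i} ≤ #(Ico (n - n / 2) n) := by
      refine card_le_card_of_injOn b (fun i hi => ?_) fun i hi j hj hij => ?_
      · have hi := mem_filter.1 hi
        exact mem_coe.2 (mem_Ico.2 ⟨hi.2, hb i hi.1⟩)
      · by_contra hne
        exact (hd i (mem_filter.1 hi).1 j (mem_filter.1 hj).1 hne).1 hij
    rw [h₁, ← hn]
    rw [Nat.card_Ico] at h₂
    omega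

/-- The case without reductions: at most one agent values the pair `0`, `n` at her target. -/
lemma exists_isCopyAlloc_of_irreducible {I : Finset ι} {v : ι → ℕ → ℝ} {t μ : ι → ℝ} {n : ℕ}
    (hn : n = I.card) (hn1 : 1 ≤ n)
    (hv : ∀ i, Antitone (v i)) (hv0 : ∀ i p, 0 ≤ v i p) (ht : ∀ i, t i = 6 / 7 * μ i)
    (hparts : ∀ i ∈ I, HasParts (v i) n (μ i)) (hy : ∀ i ∈ I, 3 * v i (2 * n) ≤ t i)
    (hpair : ∀ i ∈ I, ∀ j ∈ I, t i ≤ v i 0 + v i n → t j ≤ v j 0 + v j n → i = j) :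
    ∃ P C, IsCopyAlloc I v t P C := by
  choose! m₀ hm₀ using fun i hi => (hparts i hi).exists_mul_le_sum (hv0 i)
  let m := max (2 * n) (I.sup m₀)
  let β : ι → ℕ → ℝ := fun i j => ∑ p ∈ bagOriginals n j, v i p + ∑ p ∈ bagCopy n j, v i p
  have hinv : ∀ i ∈ I, v i 0 + v i n ≤ t i →
      ∑ j ∈ range n, max (β i j) (t i + v i (2 * n)) ≤
        ∑ j ∈ range n, β i j + ∑ p ∈ Ico (2 * n) m, v i p + v i (2 * n) := fun i hi h =>
    sum_max_bag_le (hv i) (hv0 i) hn1 (le_max_left _ _)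
      (hm₀ i hi m ((le_sup hi).trans (le_max_right _ _))) (ht i) (hy i hi) h
  have hfill : ∀ i, ∀ p ∈ Ico (2 * n) m, v i p ≤ v i (2 * n) := fun i p hp =>
    hv i (mem_Ico.1 hp).1
  by_cases he : ∃ a ∈ I, t a ≤ v a 0 + v a n
  · obtain ⟨a, ha, hta⟩ := he
    have h0 : 0 ∈ range n := mem_range.2 hn1
    obtain ⟨b, S, hb, hS, hbS, hd⟩ := exists_bagFilling v t (fun i => v i (2 * n)) β (n - 1)
      (I.erase a) ((range n).erase 0) (Ico (2 * n) m)
      (by rw [card_erase_of_mem ha, hn]) (by rw [card_erase_of_mem h0, card_range])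
      (fun i _ => hfill i) (fun i hi => by
        obtain ⟨hia, hi⟩ := mem_erase.1 hi
        have h₁ := hinv i hi (le_of_not_ge fun h => hia (hpair i hi a ha h hta))
        rw [← add_sum_erase _ _ h0, ← add_sum_erase _ (β i) h0] at h₁
        linarith [le_max_left (β i 0) (t i + v i (2 * n))])
    refine ⟨_, _, isCopyAlloc_of_bags (b := Function.update b a 0)
      (S := Function.update S a ∅) hn ?_ ?_ ?_ ?_⟩
    · intro i hi
      rcases eq_or_ne i a with rfl | hia
      · simpa using Nat.pos_of_ne_zero (by omega)
      · simpa [hia] using mem_range.1 (mem_of_mem_erase (hb i (mem_erase.2 ⟨hia, hi⟩)))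
    · intro i hi
      rcases eq_or_ne i a with rfl | hia
      · simp
      · simpa [hia] using fun p hp => (mem_Ico.1 (hS i (mem_erase.2 ⟨hia, hi⟩) hp)).1
    · intro i hi
      rcases eq_or_ne i a with rfl | hia
      · have h₁ : ∑ p ∈ bagOriginals n 0, v i p = v i 0 + v i n := sum_pair (by omega)
        have h₂ : 0 ≤ ∑ p ∈ bagCopy n 0, v i p := sum_nonneg fun p _ => hv0 i p
        simp only [Function.update_self, sum_empty]
        linarith
      · simpa [hia] using hbS i (mem_erase.2 ⟨hia, hi⟩)
    · have key : ∀ i ∈ I, i ≠ a → b i ≠ 0 := fun i hi hia =>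
        ne_of_mem_erase (hb i (mem_erase.2 ⟨hia, hi⟩))
      intro i hi j hj hij
      rcases eq_or_ne i a with rfl | hia
      · simpa [hij.symm] using (key j hj hij.symm).symm
      · rcases eq_or_ne j a with rfl | hja
        · simpa [hia] using key i hi hia
        · simpa [hia, hja] using hd i (mem_erase.2 ⟨hia, hi⟩) j (mem_erase.2 ⟨hja, hj⟩) hij
  · push Not at he
    obtain ⟨b, S, hb, hS, hbS, hd⟩ := exists_bagFilling v t (fun i => v i (2 * n)) β n
      I (range n) (Ico (2 * n) m) hn.symm (card_range n) (fun i _ => hfill i)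
      (fun i hi => hinv i hi (he i hi).le)
    exact ⟨_, _, isCopyAlloc_of_bags hn (fun i hi => mem_range.1 (hb i hi))
      (fun i hi p hp => (mem_Ico.1 (hS i hi hp)).1) hbS hd⟩

theorem exists_isCopyAlloc (k : ℕ) : ∀ (I : Finset ι) (v : ι → ℕ → ℝ) (t μ : ι → ℝ),
    I.card = k → (∀ i, Antitone (v i)) → (∀ i p, 0 ≤ v i p) → (∀ i, t i = 6 / 7 * μ i) →
    (∀ i ∈ I, HasParts (v i) I.card (μ i)) → ∃ P C, IsCopyAlloc I v t P C := by
  induction k using Nat.strong_induction_on with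
  | _ k ih =>
  intro I v t μ hk hv hv0 ht hparts
  rcases I.eq_empty_or_nonempty with rfl | hI
  · exact ⟨fun _ => ∅, fun _ => ∅, by constructor <;> simp⟩
  have hI1 : 1 ≤ I.card := card_pos.2 hI
  by_cases htriple : ∃ i ∈ I,
      t i ≤ ∑ p ∈ ({2 * I.card - 2, 2 * I.card - 1, 2 * I.card} : Finset ℕ), v i p
  · obtain ⟨i, hi, hti⟩ := htriple
    obtain ⟨e, he⟩ := exists_orderEmbedding_avoiding
      {2 * I.card - 2, 2 * I.card - 1, 2 * I.card}
    obtain ⟨P, C, h⟩ := ih (k - 1) (by omega) (I.erase i) (fun a => v a ∘ e) t μ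
      (by rw [card_erase_of_mem hi, hk]) (fun a => (hv a).comp_monotone e.monotone)
      (fun a p => hv0 a _) ht (fun a ha => by
        rw [card_erase_of_mem hi]
        exact (hparts a (mem_of_mem_erase ha)).comp_of_triple (hv a) (hv0 a) hI1 e he)
    have h' := (IsCopyAlloc.singleton hti).union e (by simp) (fun a p hp => ?_) (by simp) h
    · rw [← insert_eq, insert_erase hi] at h'
      exact ⟨_, _, h'⟩
    · rw [he, not_not]
      split_ifs at hp
      · exact hp
      · simp at hp
  by_cases hpair : ∀ i ∈ I, ∀ j ∈ I,
      t i ≤ v i 0 + v i I.card → t j ≤ v j 0 + v j I.card → i = j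
  · refine exists_isCopyAlloc_of_irreducible rfl hI1 hv hv0 ht hparts (fun i hi => ?_) hpair
    push Not at htriple
    have h₁ := htriple i hi
    rw [sum_insert (by simp; omega), sum_pair (by omega)] at h₁
    have h₂ := hv i (show 2 * I.card - 2 ≤ 2 * I.card by omega)
    have h₃ := hv i (show 2 * I.card - 1 ≤ 2 * I.card by omega)
    linarith
  · push Not at hpair
    obtain ⟨i, hi, j, hj, hti, htj, hij⟩ := hpair
    have hI2 : 2 ≤ I.card := by
      rw [← card_pair hij]
      exact card_le_card (insert_subset hi (singleton_subset_iff.2 hj))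
    obtain ⟨e, he⟩ := exists_orderEmbedding_avoiding {0, I.card - 1, I.card}
    have hsub : ({i, j} : Finset ι) ⊆ I := insert_subset hi (singleton_subset_iff.2 hj)
    have hcard : (I \ {i, j}).card = I.card - 2 := by
      rw [card_sdiff_of_subset hsub, card_pair hij]
    obtain ⟨P, C, h⟩ := ih (k - 2) (by omega) (I \ {i, j}) (fun a => v a ∘ e) t μ
      (by rw [hcard, hk]) (fun a => (hv a).comp_monotone e.monotone)
      (fun a p => hv0 a _) ht (fun a ha => by
        rw [hcard]
        exact (hparts a (mem_sdiff.1 ha).1).comp_of_pair (hv a) (hv0 a) hI1 e he)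
    have h' := (IsCopyAlloc.pair (x := I.card - 1) (y := I.card) hij (by omega) (by omega)
      (by omega) (hti.trans (by gcongr; exact hv i (by omega))) htj).union e disjoint_sdiff
      (fun a p hp => ?_) (fun a p hp => ?_) h
    · rw [union_sdiff_of_subset hsub] at h'
      exact ⟨_, _, h'⟩
    · rw [he, not_not]
      split_ifs at hp <;> simp at hp ⊢ <;> omega
    · rw [he, not_not]
      split_ifs at hp <;> simp at hp ⊢
      omega

end

lemma exists_injective_of_card_le {κ α : Type*} [DecidableEq α] (pos : κ → ℕ)
    (T : κ → Finset α)
    (h : ∀ s : Finset κ, ∀ k ∈ s, (∀ k' ∈ s, pos k' ≤ pos k) → s.card ≤ (T k).card) :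
    ∃ f : κ → α, Function.Injective f ∧ ∀ k, f k ∈ T k := by
  refine (all_card_le_biUnion_card_iff_exists_injective T).1 fun s => ?_
  rcases s.eq_empty_or_nonempty with rfl | hs
  · simp
  obtain ⟨k, hk, hmax⟩ := exists_max_image s pos hs
  exact (h s k hk hmax).trans (card_le_card (subset_biUnion_of_mem T hk))

lemma sum_le_sum_of_card_le {u : ℕ → ℝ} (hu : Antitone u) (hu0 : ∀ p, 0 ≤ u p)
    {A B : Finset ℕ} (h : ∀ q, #{p ∈ A | p ≤ q} ≤ #{p ∈ B | p ≤ q}) :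
    ∑ p ∈ A, u p ≤ ∑ p ∈ B, u p := by
  obtain ⟨f, hf, hfB⟩ := exists_injective_of_card_le (fun a : A => (a : ℕ))
    (fun a => {p ∈ B | p ≤ (a : ℕ)}) fun s k _ hmax => by
      refine le_trans ?_ (h k)
      rw [← card_map (Function.Embedding.subtype (· ∈ A)) (s := s)]
      refine card_le_card fun p hp => ?_
      obtain ⟨a, ha, rfl⟩ := mem_map.1 hp
      exact mem_filter.2 ⟨a.2, hmax a ha⟩
  rw [← sum_coe_sort A]
  calc ∑ a : A, u a ≤ ∑ a : A, u (f a) :=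
        sum_le_sum fun a _ => hu (mem_filter.1 (hfB a)).2
    _ = ∑ p ∈ univ.map ⟨f, hf⟩, u p := (sum_map univ ⟨f, hf⟩ u).symm
    _ ≤ ∑ p ∈ B, u p := by
      refine sum_le_sum_of_subset_of_nonneg (fun p hp => ?_) fun _ _ _ => hu0 _
      obtain ⟨a, -, rfl⟩ := mem_map.1 hp
      exact (mem_filter.1 (hfB a)).1

section

variable {ι H : Type*} [Fintype ι] [DecidableEq ι] [DecidableEq H]

/-- Distinct goods `π i (ρ i p)` can be chosen for all positions `p`, with `p` held by agent `i`
and the rank `ρ i p` taken from a sufficiently large set of acceptable ranks. -/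
lemma exists_distinct_goods {π : ι → ℕ → H} (hπ : ∀ i, Function.Injective (π i))
    {P : ι → Finset ℕ} (hP : ∀ i j, i ≠ j → Disjoint (P i) (P j)) (T : ι → ℕ → Finset ℕ)
    (hT : ∀ i, ∀ p ∈ P i, #{q ∈ univ.biUnion P | q ≤ p} ≤ (T i p).card) :
    ∃ ρ : ι → ℕ → ℕ, (∀ i, ∀ p ∈ P i, ρ i p ∈ T i p) ∧
      ∀ i j p q, p ∈ P i → q ∈ P j → π i (ρ i p) = π j (ρ j q) → i = j ∧ p = q := by
  let κ := Σ i, {p // p ∈ P i}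
  have hinj : Function.Injective fun k : κ => (k.2 : ℕ) := by
    rintro ⟨i, p, hp⟩ ⟨j, q, hq⟩ h
    dsimp only at h
    subst h
    by_cases hij : i = j
    · subst hij
      rfl
    · exact absurd hq (disjoint_left.1 (hP i j hij) hp)
  obtain ⟨f, hf, hfT⟩ := exists_injective_of_card_le (fun k : κ => (k.2 : ℕ))
    (fun k => (T k.1 k.2).image (π k.1)) fun s k _ hmax => by
      rw [card_image_of_injective _ (hπ _), ← card_map ⟨_, hinj⟩]
      refine (card_le_card fun p hp => ?_).trans (hT k.1 k.2 k.2.2)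
      obtain ⟨k', hk', rfl⟩ := mem_map.1 hp
      exact mem_filter.2 ⟨mem_biUnion.2 ⟨k'.1, mem_univ _, k'.2.2⟩, hmax k' hk'⟩
  choose ρ hρ hρf using fun k => mem_image.1 (hfT k)
  refine ⟨fun i p => if h : p ∈ P i then ρ ⟨i, p, h⟩ else 0, fun i p hp => ?_,
    fun i j p q hp hq h => ?_⟩
  · simpa [hp] using hρ ⟨i, p, hp⟩
  · simp only [hp, hq, dif_pos] at h
    rw [hρf ⟨i, p, hp⟩, hρf ⟨j, q, hq⟩] at h
    have := hf h
    exact ⟨congrArg Sigma.fst this, congrArg (fun k : κ => (k.2 : ℕ)) this⟩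

/-- The ranks `r` outside `R` for which `insert r R` dominates `insert d A`, as long as `R`
dominates `A`. -/
noncomputable def acceptableRanks (R A : Finset ℕ) (N d : ℕ) : Finset ℕ :=
  open Classical in
  {r ∈ range N | r ∉ R ∧ ∀ q, d ≤ q → q < r → #{p ∈ A | p ≤ q} < #{p ∈ R | p ≤ q}}

lemma card_le_card_acceptableRanks {R A D : Finset ℕ} {d : ℕ} (hAD : Disjoint A D) :
    #{p ∈ D | p ≤ d} ≤ (acceptableRanks R A (R.card + D.card) d).card := by
  classical
  by_contra! hlt
  set T := acceptableRanks R A (R.card + D.card) d with hT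
  have hD := card_filter_le D (· ≤ d)
  have hex : ∃ r, r ∉ R ∪ T ∧ r < R.card + D.card := by
    by_contra! h
    have h₁ : range (R.card + D.card) ⊆ R ∪ T := by
      intro r hr
      by_contra hr'
      exact absurd (h r hr') (by simpa using hr)
    have h₂ := card_le_card h₁
    have h₃ := card_union_le R T
    rw [card_range] at h₂
    omega
  obtain ⟨hr, hrN⟩ := Nat.find_spec hex
  have hmin := fun q (hq : q < Nat.find hex) => Nat.find_min hex hq
  generalize Nat.find hex = r at hr hrN hmin
  rw [mem_union, not_or] at hr
  refine hr.2 (mem_filter.2 ⟨mem_range.2 hrN, hr.1, fun q hdq hqr => ?_⟩)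
  have h₁ : range (q + 1) ⊆ {p ∈ R | p ≤ q} ∪ T := by
    intro p hp
    rw [mem_range] at hp
    have h := hmin p (by omega)
    have hp' : p ∈ R ∪ T := by
      by_contra h'
      exact h ⟨h', by omega⟩
    rcases mem_union.1 hp' with hp' | hp'
    · exact mem_union_left _ (mem_filter.2 ⟨hp', by omega⟩)
    · exact mem_union_right _ hp'
  have h₂ := (card_le_card h₁).trans (card_union_le _ _)
  have h₃ : {p ∈ A | p ≤ q} ∪ {p ∈ D | p ≤ d} ⊆ range (q + 1) := by
    intro p hp
    simp only [mem_union, mem_filter, mem_range] at hp ⊢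
    omega
  have h₄ := card_le_card h₃
  rw [card_union_of_disjoint (hAD.mono (filter_subset _ _) (filter_subset _ _))] at h₄
  rw [card_range] at h₂ h₄
  omega

/-- An allocation of positions yields an allocation of goods in which every agent does at least as
well, whatever the orders `π i` in which the agents rank the goods. -/
lemma IsCopyAlloc.exists_goods {v : ι → ℕ → ℝ} {t : ι → ℝ} {P C : ι → Finset ℕ}
    (h : IsCopyAlloc univ v t P C) (hv : ∀ i, Antitone (v i)) (hv0 : ∀ i p, 0 ≤ v i p)
    {π : ι → ℕ → H} (hπ : ∀ i, Function.Injective (π i)) :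
    ∃ B K : ι → Finset H, (∀ i j, i ≠ j → Disjoint (B i) (B j)) ∧
      (∀ i j, i ≠ j → Disjoint (K i) (K j)) ∧ (∀ i, (K i).card ≤ (C i).card) ∧
      ∀ i (w : H → ℝ), (∀ p, w (π i p) = v i p) → t i ≤ ∑ x ∈ B i ∪ K i, w x := by
  obtain ⟨ρ, hρ, hρinj⟩ := exists_distinct_goods hπ h.disjoint_originals
    (fun _ p => range (p + 1)) fun i p _ => by
      refine card_le_card fun q hq => ?_
      simp only [mem_filter, mem_range] at hq ⊢
      omega
  let R : ι → Finset ℕ := fun i => (P i).image (ρ i)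
  obtain ⟨σ, hσ, hσinj⟩ := exists_distinct_goods hπ h.disjoint_copies
    (fun i d => acceptableRanks (R i) (P i) ((R i).card + (univ.biUnion C).card) d)
    fun i d hd => card_le_card_acceptableRanks
      ((disjoint_biUnion_right _ _ _).2 fun j _ => h.disjoint_originals_copies i j ⟨d, hd⟩)
  refine ⟨fun i => (R i).image (π i), fun i => ((C i).image (σ i)).image (π i), ?_, ?_,
    fun i => card_image_le.trans card_image_le, ?_⟩
  · intro i j hij
    rw [disjoint_left]
    simp only [R, mem_image]
    rintro _ ⟨_, ⟨p, hp, rfl⟩, rfl⟩ ⟨_, ⟨q, hq, rfl⟩, h'⟩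
    exact hij (hρinj j i q p hq hp h').1.symm
  · intro i j hij
    rw [disjoint_left]
    simp only [mem_image]
    rintro _ ⟨_, ⟨p, hp, rfl⟩, rfl⟩ ⟨_, ⟨q, hq, rfl⟩, h'⟩
    exact hij (hσinj j i q p hq hp h').1.symm
  · intro i w hw
    have hR : ∀ q, #{p ∈ P i | p ≤ q} ≤ #{p ∈ R i | p ≤ q} := by
      intro q
      refine card_le_card_of_injOn (ρ i) (fun p hp => ?_) fun p hp p' hp' hpp => ?_
      · obtain ⟨hp, hpq⟩ := mem_filter.1 hp
        have := mem_range.1 (hρ i p hp)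
        exact mem_coe.2 (mem_filter.2 ⟨mem_image_of_mem _ hp, by omega⟩)
      · exact (hρinj i i p p' (mem_filter.1 hp).1 (mem_filter.1 hp').1 (by rw [hpp])).2
    rw [← image_union, sum_image fun _ _ _ _ h => hπ i h]
    rw [sum_congr rfl fun p _ => hw p]
    refine (h.le_value i (mem_univ i)).trans ?_
    rcases (C i).eq_empty_or_nonempty with hC | hC
    · simpa [hC] using sum_le_sum_of_card_le (hv i) (hv0 i) hR
    obtain ⟨d, hCd⟩ := card_eq_one.1 (le_antisymm (h.card_copies_le i) (card_pos.2 hC))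
    have hdC : d ∈ C i := by simp [hCd]
    have hdP : d ∉ P i := disjoint_right.1 (h.disjoint_originals_copies i i hC) hdC
    obtain ⟨-, hσR, hσA⟩ := mem_filter.1 (hσ i d hdC)
    rw [← sum_union (h.disjoint_originals_copies i i hC), hCd, image_singleton]
    refine sum_le_sum_of_card_le (hv i) (hv0 i) fun q => ?_
    rw [union_comm, ← insert_eq, union_comm, ← insert_eq, filter_insert, filter_insert]
    have h₁ : #(insert d {p ∈ P i | p ≤ q}) = #{p ∈ P i | p ≤ q} + 1 :=
      card_insert_of_notMem fun h => hdP (mem_filter.1 h).1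
    have h₂ : #(insert (σ i d) {p ∈ R i | p ≤ q}) = #{p ∈ R i | p ≤ q} + 1 :=
      card_insert_of_notMem fun h => hσR (mem_filter.1 h).1
    have h₃ := hR q
    have h₄ := hσA q
    split_ifs <;> omega

end

/-- An enumeration of `G`, continued by dummies worth `0`, along which the value decreases. -/
lemma exists_antitone_enumeration {G : Type*} [Fintype G] (w : G → ℝ) (hw : ∀ g, 0 ≤ w g) :
    ∃ π : ℕ → G ⊕ ℕ, Function.Injective π ∧ Antitone (fun p => Sum.elim w (fun _ => 0) (π p)) ∧
      ∀ g, ∃ p < Fintype.card G, π p = Sum.inl g := by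
  let f := (Fintype.equivFin G).symm
  let s := Tuple.sort fun k => -w (f k)
  have hs : Monotone fun k => -w (f (s k)) := Tuple.monotone_sort fun k => -w (f k)
  let π : ℕ → G ⊕ ℕ := fun p =>
    if h : p < Fintype.card G then Sum.inl (f (s ⟨p, h⟩)) else Sum.inr p
  refine ⟨π, fun p q h => ?_, fun p q hpq => ?_, fun g => ?_⟩
  · by_cases hp : p < Fintype.card G <;> by_cases hq : q < Fintype.card G <;>
      simp_all [π]
  · by_cases hq : q < Fintype.card G
    · have hp : p < Fintype.card G := hpq.trans_lt hq
      simpa [π, hp, hq] using hs (show (⟨p, hp⟩ : Fin _) ≤ ⟨q, hq⟩ from hpq)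
    · by_cases hp : p < Fintype.card G <;> simp [π, hp, hq, hw]
  · exact ⟨s.symm (f.symm g), Fin.is_lt _, by simp [π]⟩

lemma mms_nonneg {G : Type*} {n : ℕ} {w : G → ℝ} (hw : ∀ g, 0 ≤ w g) (S : Finset G) :
    0 ≤ mms (fun S => ∑ g ∈ S, w g) n S :=
  Real.iSup_nonneg fun _ => Real.iInf_nonneg fun _ => sum_nonneg fun g _ => hw g

lemma hasParts_mms {G : Type*} [Fintype G] {n : ℕ} (hn : 1 ≤ n) (w : G → ℝ)
    (hw : ∀ g, 0 ≤ w g) {π : ℕ → G ⊕ ℕ} (hG : ∀ g, ∃ p < Fintype.card G, π p = Sum.inl g) :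
    HasParts (fun p => Sum.elim w (fun _ => 0) (π p)) n
      (mms (fun S => ∑ g ∈ S, w g) n univ) := by
  have : NeZero n := ⟨by omega⟩
  obtain ⟨Q, hQ⟩ := exists_eq_ciSup_of_finite
    (f := fun P : G → Fin n => ⨅ j : Fin n, ∑ g with P g = j, w g)
  choose r hr hrπ using hG
  have hrinj : Function.Injective r := fun g g' h => by
    simpa [hrπ] using congrArg π h
  refine ⟨fun p => Sum.elim (fun g => (Q g : ℕ)) (fun _ => n) (π p), range n, Fintype.card G,
    (card_range n).ge, fun l hl => ?_⟩
  rw [mem_range] at hl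
  rw [mms, ← hQ]
  refine (ciInf_le (Set.finite_range _).bddBelow ⟨l, hl⟩).trans ?_
  calc ∑ g with Q g = ⟨l, hl⟩, w g
      = ∑ p ∈ ({g | Q g = ⟨l, hl⟩} : Finset G).map ⟨r, hrinj⟩,
          Sum.elim w (fun _ => 0) (π p) := by
        rw [sum_map]
        exact sum_congr rfl fun g _ => by simp [hrπ]
    _ ≤ _ := by
      refine sum_le_sum_of_subset_of_nonneg (fun p hp => ?_) fun p _ _ => ?_
      · obtain ⟨g, hg, rfl⟩ := mem_map.1 hp
        simpa [hrπ, hr, Fin.ext_iff] using hg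
      · rcases π p with g | k <;> simp [hw]

lemma sum_sumElim_zero {G : Type*} (w : G → ℝ) (S : Finset (G ⊕ ℕ)) :
    ∑ x ∈ S, Sum.elim w (fun _ => 0) x = ∑ g ∈ S.toLeft, w g := by
  rw [← toLeft_disjSum_toRight (u := S), sum_disjSum]
  simp

/-- Every instance with `n` agents and additive valuations admits, for any
`0 ≤ α ≤ 6/7`, an `α`-MMS allocation with copies in which every good belongs to at most two
bundles and at most `⌊n/2⌋` goods belong to two bundles. -/
theorem stmt16 {G : Type*} [Fintype G] [DecidableEq G] (n : ℕ)
    (w : Fin n → G → ℝ) (hw : ∀ i g, 0 ≤ w i g)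
    (α : ℝ) (hα0 : 0 ≤ α) (hα1 : α ≤ 6 / 7) :
    ∃ A : Fin n → Finset G,
      (∀ i, α * mms (fun S => ∑ g ∈ S, w i g) n Finset.univ ≤ ∑ g ∈ A i, w i g) ∧
      (∀ g : G, (Finset.univ.filter fun i => g ∈ A i).card ≤ 2) ∧
      (Finset.univ.filter fun g : G =>
        (Finset.univ.filter fun i => g ∈ A i).card = 2).card ≤ n / 2 := by
  choose π hπ hv hG using fun i => exists_antitone_enumeration (w i) (hw i)
  have hv0 : ∀ i p, 0 ≤ Sum.elim (w i) (fun _ => 0) (π i p) := by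
    intro i p
    rcases π i p with g | k <;> simp [hw]
  obtain ⟨P, C, h⟩ := exists_isCopyAlloc n univ
    (fun i p => Sum.elim (w i) (fun _ => 0) (π i p))
    (fun i => 6 / 7 * mms (fun S => ∑ g ∈ S, w i g) n univ) _ (Finset.card_fin n) hv hv0
    (fun i => rfl) fun i _ => by
      rw [Finset.card_fin]
      exact hasParts_mms (by have := i.2; omega) (w i) (hw i) (hG i)
  obtain ⟨B, K, hB, hK, hKC, hBK⟩ := h.exists_goods hv hv0 hπ
  have honeB : ∀ g : G, #{i | Sum.inl g ∈ B i} ≤ 1 := fun g => card_le_one.2 fun i hi j hj =>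
    by_contra fun hij => disjoint_left.1 (hB i j hij) (mem_filter.1 hi).2 (mem_filter.1 hj).2
  have honeK : ∀ g : G, #{i | Sum.inl g ∈ K i} ≤ 1 := fun g => card_le_one.2 fun i hi j hj =>
    by_contra fun hij => disjoint_left.1 (hK i j hij) (mem_filter.1 hi).2 (mem_filter.1 hj).2
  have hcount : ∀ g : G, #{i | g ∈ (B i ∪ K i).toLeft} ≤
      #{i | Sum.inl g ∈ B i} + #{i | Sum.inl g ∈ K i} := by
    intro g
    refine le_trans (card_le_card fun i hi => ?_) (card_union_le _ _)
    simpa using hi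
  refine ⟨fun i => (B i ∪ K i).toLeft, fun i => ?_, fun g => ?_, ?_⟩
  · rw [← sum_sumElim_zero]
    exact (mul_le_mul_of_nonneg_right hα1 (mms_nonneg (hw i) _)).trans
      (hBK i _ fun _ => rfl)
  · have := hcount g
    have := honeB g
    have := honeK g
    dsimp only
    omega
  · have hsub : ({g | #{i | g ∈ (B i ∪ K i).toLeft} = 2} : Finset G) ⊆
        (univ.biUnion K).toLeft := by
      intro g hg
      have h₁ := (mem_filter.1 hg).2
      have h₂ := hcount g
      have h₃ := honeB g
      obtain ⟨i, hi⟩ : ({i | Sum.inl g ∈ K i} : Finset (Fin n)).Nonempty :=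
        card_pos.1 (by omega)
      exact mem_toLeft.2 (mem_biUnion.2 ⟨i, mem_univ i, (mem_filter.1 hi).2⟩)
    have h₁ := (card_le_card hsub).trans (card_toLeft_le.trans card_biUnion_le)
    have h₂ := sum_le_sum fun i (_ : i ∈ univ) => hKC i
    have h₃ := h.two_mul_card_copies_le
    rw [Finset.card_fin] at h₃
    dsimp only
    omega
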